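/- Let K be a field of characteristic zero, r ≥ 2, and let L be the free nilpotent Lie algebra of rank r and step 3 over K, with G_1 the span of the generators X_1, …, X_r. Fix p ∈ L* and set h_1(p) = {ξ ∈ G_1 : p(⁅ξ,η⁆) = 0 for all η ∈ C_1(L)}, k(p) = {γ ∈ h_1(p) : p(⁅δ,γ⁆) = 0 for all δ ∈ h_1(p)}, N(p) = {η ∈ C_1(L) : p(⁅ξ,η⁆) = 0 for all ξ ∈ G_1}, and let R(p) = {v ∈ L : p(⁅w,v⁆) = 0 for all w ∈ L} be the radical of B_p. Then dim R(p) = dim k(p) + dim N(p). -/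

import Mathlib

/-- The free nilpotent Lie algebra of rank `r` and step `s` over `K`: the quotient of the
free Lie algebra `F` on `r` generators by the `s`-th term `C_s(F)` of its lower central
series (`C_0 = F`, `C_{k+1} = ⁅F, C_k⁆`). -/
abbrev FreeNilpotentLie (K : Type*) [Field K] (r s : ℕ) :=
  FreeLieAlgebra K (Fin r) ⧸
    LieModule.lowerCentralSeries K (FreeLieAlgebra K (Fin r)) (FreeLieAlgebra K (Fin r)) s

/-- The canonical generators `X_1, …, X_r` of the free nilpotent Lie algebra, i.e. the images
of the free generators. -/
noncomputable def FreeNilpotentLie.gen (K : Type*) [Field K] (r s : ℕ) (i : Fin r) :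
    FreeNilpotentLie K r s :=
  LieSubmodule.Quotient.mk' _ (FreeLieAlgebra.of K i)

/-- `G₁`: the `K`-span of the generators. -/
noncomputable def FreeNilpotentLie.G1 (K : Type*) [Field K] (r s : ℕ) :
    Submodule K (FreeNilpotentLie K r s) :=
  Submodule.span K (Set.range (FreeNilpotentLie.gen K r s))


/-- The radical of the skew form `B_p(x, y) = p ⁅x, y⁆`. -/
noncomputable def radicalBp {K L : Type*} [Field K] [LieRing L] [LieAlgebra K L]
    (p : Module.Dual K L) : Submodule K L where
  carrier := {v | ∀ w : L, p ⁅w, v⁆ = 0}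
  add_mem' := fun {a b} ha hb w => by simp [lie_add, ha w, hb w]
  zero_mem' := fun w => by simp
  smul_mem' := fun c x hx w => by simp [lie_smul, hx w]

/-- `{ξ | ∀ η ∈ S, p ⁅ξ, η⁆ = 0}` as a subspace. -/
noncomputable def perpRight {K L : Type*} [Field K] [LieRing L] [LieAlgebra K L]
    (p : Module.Dual K L) (S : Set L) : Submodule K L where
  carrier := {ξ : L | ∀ η ∈ S, p ⁅ξ, η⁆ = 0}
  add_mem' := fun {a b} ha hb η hη => by simp [add_lie, ha η hη, hb η hη]
  zero_mem' := fun η hη => by simp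
  smul_mem' := fun c x hx η hη => by simp [smul_lie, hx η hη]

/-- `{η | ∀ ξ ∈ S, p ⁅ξ, η⁆ = 0}` as a subspace. -/
noncomputable def perpLeft {K L : Type*} [Field K] [LieRing L] [LieAlgebra K L]
    (p : Module.Dual K L) (S : Set L) : Submodule K L where
  carrier := {η : L | ∀ ξ ∈ S, p ⁅ξ, η⁆ = 0}
  add_mem' := fun {a b} ha hb ξ hξ => by simp [lie_add, ha ξ hξ, hb ξ hξ]
  zero_mem' := fun ξ hξ => by simp
  smul_mem' := fun c x hx ξ hξ => by simp [lie_smul, hx ξ hξ]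

section Generation

open LieModule Module

variable {K L : Type*} [Field K] [LieRing L] [LieAlgebra K L]

/-- If `G` generates `L` as a Lie algebra, then `L = G + ⁅L, L⁆`. -/
theorem sup_lowerCentralSeries_one_eq_top {G : Submodule K L}
    (hG : LieSubalgebra.lieSpan K L (G : Set L) = ⊤) :
    G ⊔ (lowerCentralSeries K L L 1).toSubmodule = ⊤ := by
  refine eq_top_iff.2 fun x _ => ?_
  have hx : x ∈ LieSubalgebra.lieSpan K L (G : Set L) := hG ▸ LieSubalgebra.mem_top x
  induction hx using LieSubalgebra.lieSpan_induction with
  | mem x hx => exact Submodule.mem_sup_left hx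
  | zero => exact zero_mem _
  | add x y _ _ hx hy => exact add_mem (hx trivial) (hy trivial)
  | smul a x _ hx => exact Submodule.smul_mem _ _ (hx trivial)
  | lie x y _ _ _ _ =>
    refine Submodule.mem_sup_right ?_
    change ⁅x, y⁆ ∈ lowerCentralSeries K L L 1
    rw [lowerCentralSeries_succ]
    exact LieSubmodule.lie_mem_lie (LieSubmodule.mem_top x) (LieSubmodule.mem_top y)

theorem lie_mem_lowerCentralSeries_succ {k : ℕ} (x : L) {y : L}
    (hy : y ∈ lowerCentralSeries K L L k) : ⁅x, y⁆ ∈ lowerCentralSeries K L L (k + 1) := by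
  rw [lowerCentralSeries_succ]
  exact LieSubmodule.lie_mem_lie (LieSubmodule.mem_top x) hy

/-- `⁅C₁(L), C_k(L)⁆ ⊆ C_{k+2}(L)`. -/
theorem lie_mem_lowerCentralSeries_add_two {k : ℕ} {x y : L}
    (hx : x ∈ lowerCentralSeries K L L 1) (hy : y ∈ lowerCentralSeries K L L k) :
    ⁅x, y⁆ ∈ lowerCentralSeries K L L (k + 2) := by
  rw [lowerCentralSeries_succ, ← LieSubmodule.mem_toSubmodule,
    LieSubmodule.lieIdeal_oper_eq_linear_span'] at hx
  induction hx using Submodule.span_induction with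
  | mem x hx =>
    obtain ⟨a, _, b, _, rfl⟩ := hx
    rw [lie_lie]
    exact sub_mem
      (lie_mem_lowerCentralSeries_succ a (lie_mem_lowerCentralSeries_succ b hy))
      (lie_mem_lowerCentralSeries_succ b (lie_mem_lowerCentralSeries_succ a hy))
  | zero => simp
  | add x y _ _ hx hy => rw [add_lie]; exact add_mem hx hy
  | smul a x _ hx => rw [smul_lie]; exact SMulMemClass.smul_mem a hx

/-- The span of the right-normed brackets of `k + 1` elements of `G`. -/
noncomputable def iteratedBracket (G : Submodule K L) : ℕ → Submodule K L
  | 0 => G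
  | k + 1 => Submodule.map₂ (toEnd K L L : L →ₗ[K] End K L) G (iteratedBracket G k)

theorem iteratedBracket_fg {G : Submodule K L} (hG : G.FG) (k : ℕ) :
    (iteratedBracket G k).FG := by
  induction k with
  | zero => exact hG
  | succ k ih => exact hG.map₂ _ ih

theorem iteratedBracket_le_lowerCentralSeries (G : Submodule K L) (k : ℕ) :
    iteratedBracket G k ≤ (lowerCentralSeries K L L k).toSubmodule := by
  induction k with
  | zero => simp
  | succ k ih =>
    exact Submodule.map₂_le.2 fun x _ y hy => lie_mem_lowerCentralSeries_succ x (ih hy)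

/-- A nilpotent Lie algebra generated by a finite-dimensional subspace is finite-dimensional. -/
theorem finiteDimensional_of_lieSpan_eq_top {G : Submodule K L} (hfg : G.FG)
    (hG : LieSubalgebra.lieSpan K L (G : Set L) = ⊤) {s : ℕ}
    (hs : lowerCentralSeries K L L s = ⊥) : FiniteDimensional K L := by
  set S : Submodule K L := ⨆ k : Fin (s + 1), iteratedBracket G k with hS
  have hle (k : ℕ) : iteratedBracket G k ≤ S := by
    rcases lt_or_ge k (s + 1) with h | h
    · exact le_iSup (fun k : Fin (s + 1) => iteratedBracket G k) ⟨k, h⟩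
    · refine (iteratedBracket_le_lowerCentralSeries G k).trans ?_
      have h' := antitone_lowerCentralSeries K L L (show s ≤ k by omega)
      rw [hs, le_bot_iff] at h'
      simp [h']
  have hstable (x : L) : ∀ y ∈ S, ⁅x, y⁆ ∈ S := by
    have hx : x ∈ LieSubalgebra.lieSpan K L (G : Set L) := hG ▸ LieSubalgebra.mem_top x
    induction hx using LieSubalgebra.lieSpan_induction with
    | mem x hx =>
      have : S ≤ S.comap (toEnd K L L x) := by
        conv_lhs => rw [hS]
        refine iSup_le fun k y hy => hle (k + 1) ?_
        exact Submodule.apply_mem_map₂ (toEnd K L L : L →ₗ[K] End K L) hx hy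
      exact this
    | zero => simp
    | add x y _ _ hx hy => intro z hz; rw [add_lie]; exact add_mem (hx z hz) (hy z hz)
    | smul a x _ hx => intro z hz; rw [smul_lie]; exact S.smul_mem a (hx z hz)
    | lie x y _ _ hx hy =>
      intro z hz
      rw [lie_lie]
      exact sub_mem (hx _ (hy z hz)) (hy _ (hx z hz))
  have htop : S = ⊤ := by
    refine eq_top_iff.2 fun x _ => ?_
    have hx : x ∈ LieSubalgebra.lieSpan K L (G : Set L) := hG ▸ LieSubalgebra.mem_top x
    induction hx using LieSubalgebra.lieSpan_induction with
    | mem x hx => exact hle 0 hx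
    | zero => exact zero_mem _
    | add x y _ _ hx hy => exact add_mem (hx trivial) (hy trivial)
    | smul a x _ hx => exact S.smul_mem _ (hx trivial)
    | lie x y _ _ _ hy => exact hstable x y (hy trivial)
  exact ⟨htop ▸ Submodule.fg_iSup _ fun k => iteratedBracket_fg hfg k⟩

end Generation

section Radical

open LieModule Module

variable {K L : Type*} [Field K] [LieRing L] [LieAlgebra K L]

/-- Every functional vanishing on `V ⊓ perpRight p W` agrees on `V` with `p ⁅·, w⁆` for some
`w ∈ W`. -/
theorem exists_mem_forall_apply_lie_eq [FiniteDimensional K L] (p : Dual K L)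
    (V W : Submodule K L) (f : Dual K L)
    (hf : ∀ v ∈ V ⊓ perpRight p (W : Set L), f v = 0) :
    ∃ w ∈ W, ∀ v ∈ V, p ⁅v, w⁆ = f v := by
  let T : W →ₗ[K] Dual K V :=
    LinearMap.mk₂ K (fun (w : W) (v : V) => p ⁅(v : L), (w : L)⁆)
      (by simp) (by simp) (by simp) (by simp)
  have hmem : f.domRestrict V ∈ LinearMap.range T := by
    rw [← Subspace.dualCoannihilator_dualAnnihilator_eq (W := LinearMap.range T),
      Submodule.mem_dualAnnihilator]
    intro v hv
    rw [Submodule.mem_dualCoannihilator] at hv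
    exact hf v ⟨v.2, fun w hw => hv _ ⟨⟨w, hw⟩, rfl⟩⟩
  obtain ⟨w, hw⟩ := hmem
  exact ⟨w, w.2, fun v hv => LinearMap.congr_fun hw ⟨v, hv⟩⟩

/-- The dimension of the radical of `B_p` when `L = V ⊕ W` with `W` isotropic for `B_p`. -/
theorem finrank_radicalBp_of_isCompl [FiniteDimensional K L] (p : Dual K L)
    {V W : Submodule K L} (h : IsCompl V W)
    (hW : ∀ x ∈ W, ∀ y ∈ W, p ⁅x, y⁆ = 0) :
    finrank K (radicalBp p) =
      finrank K ↥((V ⊓ perpRight p (W : Set L)) ⊓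
        perpLeft p ((V ⊓ perpRight p (W : Set L) : Submodule K L) : Set L)) +
      finrank K ↥(W ⊓ perpLeft p (V : Set L)) := by
  have hswap (x y : L) : p ⁅x, y⁆ = -p ⁅y, x⁆ := by rw [← lie_skew, map_neg]
  let f := (Submodule.projection V W h).domRestrict (radicalBp p)
  have hker : (LinearMap.ker f).map (radicalBp p).subtype = W ⊓ perpLeft p (V : Set L) := by
    ext x
    constructor
    · rintro ⟨⟨x, hx⟩, hfx, rfl⟩
      exact ⟨(Submodule.projection_apply_eq_zero_iff h).1 hfx, fun v _ => hx v⟩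
    · rintro ⟨hxW, hx⟩
      refine ⟨⟨x, fun y => ?_⟩, (Submodule.projection_apply_eq_zero_iff h).2 hxW, rfl⟩
      obtain ⟨v, hv, w, hw, rfl⟩ := Submodule.mem_sup.1 (h.sup_eq_top ▸ Submodule.mem_top (x := y))
      rw [add_lie, map_add, hx v hv, hW w hw x hxW, add_zero]
  have hrange : LinearMap.range f = (V ⊓ perpRight p (W : Set L)) ⊓
      perpLeft p ((V ⊓ perpRight p (W : Set L) : Submodule K L) : Set L) := by
    ext v
    constructor
    · rintro ⟨⟨x, hx⟩, rfl⟩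
      obtain ⟨v, hv, w, hw, rfl⟩ := Submodule.mem_sup.1 (h.sup_eq_top ▸ Submodule.mem_top (x := x))
      have hfx : f ⟨v + w, hx⟩ = v := by
        simp [f, LinearMap.domRestrict_apply, Submodule.projection_apply_of_mem_right h hw,
          Submodule.projection_apply_left h ⟨v, hv⟩]
      rw [hfx]
      refine ⟨⟨hv, fun y hy => ?_⟩, fun y hy => ?_⟩
      · have := hx y
        rwa [lie_add, map_add, hW y hy w hw, add_zero, hswap, neg_eq_zero] at this
      · have := hx y
        rwa [lie_add, map_add, hy.2 w hw, add_zero] at this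
    · rintro ⟨⟨hv, hvW⟩, hvh⟩
      obtain ⟨w, hw, hvw⟩ := exists_mem_forall_apply_lie_eq p V W (p ∘ₗ toEnd K L L v)
        fun y hy => by simpa [hswap v y] using hvh y hy
      refine ⟨⟨v + w, fun y => ?_⟩, ?_⟩
      · obtain ⟨a, ha, b, hb, rfl⟩ :=
          Submodule.mem_sup.1 (h.sup_eq_top ▸ Submodule.mem_top (x := y))
        have h₁ : p ⁅a, w⁆ = p ⁅v, a⁆ := hvw a ha
        have h₂ : p ⁅b, v⁆ = 0 := by rw [hswap, hvW b hb, neg_zero]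
        simp only [add_lie, lie_add, map_add, h₁, h₂, hW b hb w hw, hswap v a]
        ring
      · simp [f, LinearMap.domRestrict_apply, Submodule.projection_apply_of_mem_right h hw,
          Submodule.projection_apply_left h ⟨v, hv⟩]
  rw [← LinearMap.finrank_range_add_finrank_ker f, hrange, ← hker,
    Submodule.finrank_map_subtype_eq]

end Radical

namespace FreeNilpotentLie

open LieModule Module

variable (K : Type*) [Field K] (r s : ℕ)

/-- The quotient map from the free Lie algebra, as a morphism of Lie algebras. -/
noncomputable def mkHom : FreeLieAlgebra K (Fin r) →ₗ⁅K⁆ FreeNilpotentLie K r s where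
  toLinearMap := (LieSubmodule.Quotient.mk' (lowerCentralSeries K (FreeLieAlgebra K (Fin r))
    (FreeLieAlgebra K (Fin r)) s) : FreeLieAlgebra K (Fin r) →ₗ[K] _)
  map_lie' := rfl

theorem mkHom_surjective : Function.Surjective (mkHom K r s) :=
  LieSubmodule.Quotient.surjective_mk' _

theorem lowerCentralSeries_eq_bot :
    lowerCentralSeries K (FreeNilpotentLie K r s) (FreeNilpotentLie K r s) s = ⊥ := by
  rw [← LieIdeal.lowerCentralSeries_map_eq s (mkHom_surjective K r s), LieIdeal.map_eq_bot_iff]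
  intro x hx
  exact (LieSubmodule.Quotient.mk_eq_zero _).2 hx

theorem lieSpan_range_of :
    LieSubalgebra.lieSpan K (FreeLieAlgebra K (Fin r)) (Set.range (FreeLieAlgebra.of K)) = ⊤ := by
  set S := LieSubalgebra.lieSpan K (FreeLieAlgebra K (Fin r)) (Set.range (FreeLieAlgebra.of K))
  let φ : FreeLieAlgebra K (Fin r) →ₗ⁅K⁆ S :=
    FreeLieAlgebra.lift K fun i => ⟨FreeLieAlgebra.of K i, LieSubalgebra.subset_lieSpan ⟨i, rfl⟩⟩
  have hφ : S.incl.comp φ = LieHom.id := by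
    ext i
    simp [φ]
  refine eq_top_iff.2 fun x _ => ?_
  have hx : (φ x : FreeLieAlgebra K (Fin r)) = x := LieHom.congr_fun hφ x
  exact hx ▸ (φ x).2

theorem lieSpan_G1 :
    LieSubalgebra.lieSpan K (FreeNilpotentLie K r s) (G1 K r s : Set (FreeNilpotentLie K r s)) =
      ⊤ := by
  refine eq_top_iff.2 fun x _ => ?_
  obtain ⟨x, rfl⟩ := mkHom_surjective K r s x
  have hx : x ∈ LieSubalgebra.lieSpan K _ (Set.range (FreeLieAlgebra.of K)) :=
    lieSpan_range_of K r ▸ LieSubalgebra.mem_top x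
  induction hx using LieSubalgebra.lieSpan_induction with
  | mem x hx =>
    obtain ⟨i, rfl⟩ := hx
    exact LieSubalgebra.subset_lieSpan (Submodule.subset_span ⟨i, rfl⟩)
  | zero => rw [map_zero]; exact zero_mem _
  | add x y _ _ hx hy => rw [map_add]; exact add_mem (hx trivial) (hy trivial)
  | smul a x _ hx => rw [map_smul]; exact LieSubalgebra.smul_mem _ _ (hx trivial)
  | lie x y _ _ hx hy => rw [LieHom.map_lie]; exact LieSubalgebra.lie_mem _ (hx trivial) (hy trivial)

theorem G1_fg : (G1 K r s).FG := Submodule.fg_span (Set.finite_range _)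

instance : FiniteDimensional K (FreeNilpotentLie K r s) :=
  finiteDimensional_of_lieSpan_eq_top (G1_fg K r s) (lieSpan_G1 K r s)
    (lowerCentralSeries_eq_bot K r s)

attribute [local instance] LieRing.ofAssociativeRing in
/-- The free Lie algebra has a linear map to `K ^ r` killing brackets and sending the generators to
the standard basis. -/
theorem exists_linearMap_of_eq_single :
    ∃ f : FreeLieAlgebra K (Fin r) →ₗ[K] (Fin r → K),
      (∀ i, f (FreeLieAlgebra.of K i) = Pi.single i 1) ∧
        ∀ x y : FreeLieAlgebra K (Fin r), f ⁅x, y⁆ = 0 := by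
  refine ⟨(FreeLieAlgebra.lift K fun i => (Pi.single i 1 : Fin r → K) :
    FreeLieAlgebra K (Fin r) →ₗ⁅K⁆ (Fin r → K)), fun i => ?_, fun x y => ?_⟩
  · exact FreeLieAlgebra.lift_of_apply _ i
  · rw [LieHom.coe_toLinearMap, LieHom.map_lie, LieRing.of_associative_ring_bracket, mul_comm,
      sub_self]

theorem disjoint_G1_lowerCentralSeries_one (hs : s ≠ 0) :
    Disjoint (G1 K r s) (lowerCentralSeries K (FreeNilpotentLie K r s)
      (FreeNilpotentLie K r s) 1).toSubmodule := by
  obtain ⟨f, hf, hlie⟩ := exists_linearMap_of_eq_single K r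
  have hker : (lowerCentralSeries K (FreeLieAlgebra K (Fin r))
      (FreeLieAlgebra K (Fin r)) s).toSubmodule ≤ LinearMap.ker f := by
    refine LE.le.trans (b := (lowerCentralSeries K (FreeLieAlgebra K (Fin r))
      (FreeLieAlgebra K (Fin r)) 1).toSubmodule)
      (antitone_lowerCentralSeries K _ _ (Nat.one_le_iff_ne_zero.2 hs)) ?_
    rw [LieModule.lowerCentralSeries_succ, LieSubmodule.lieIdeal_oper_eq_linear_span', Submodule.span_le]
    rintro _ ⟨x, _, y, _, rfl⟩
    exact hlie x y
  let g : FreeNilpotentLie K r s →ₗ[K] (Fin r → K) := Submodule.liftQ _ f hker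
  have hg (x) : g (mkHom K r s x) = f x := Submodule.liftQ_apply _ f x
  rw [Submodule.disjoint_def]
  intro x hx hxC
  have hgx : g x = 0 := by
    rw [lowerCentralSeries_succ, LieSubmodule.lieIdeal_oper_eq_linear_span'] at hxC
    refine (Submodule.span_le (p := LinearMap.ker g)).2 ?_ hxC
    rintro _ ⟨x, _, y, _, rfl⟩
    obtain ⟨x, rfl⟩ := mkHom_surjective K r s x
    obtain ⟨y, rfl⟩ := mkHom_surjective K r s y
    rw [← LieHom.map_lie]
    exact (hg _).trans (hlie x y)
  obtain ⟨c, rfl⟩ := (Submodule.mem_span_range_iff_exists_fun K).1 hx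
  have hgen (i : Fin r) : g (gen K r s i) = Pi.single i 1 := (hg _).trans (hf i)
  have hc (j : Fin r) : c j = 0 := by
    simpa [hgen, Pi.single_apply] using congrFun hgx j
  simp [hc]

theorem isCompl_G1_lowerCentralSeries_one (hs : s ≠ 0) :
    IsCompl (G1 K r s) (lowerCentralSeries K (FreeNilpotentLie K r s)
      (FreeNilpotentLie K r s) 1).toSubmodule :=
  ⟨disjoint_G1_lowerCentralSeries_one K r s hs,
    codisjoint_iff.2 (sup_lowerCentralSeries_one_eq_top (lieSpan_G1 K r s))⟩

end FreeNilpotentLie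

/-- Let `L` be the free nilpotent Lie algebra of rank `r ≥ 2` and step 3
over a field of characteristic zero and `p ∈ L*`.  With
`h₁(p) = {ξ ∈ G₁ : p ⁅ξ, η⁆ = 0 ∀ η ∈ C₁(L)}`,
`k(p) = {γ ∈ h₁(p) : p ⁅δ, γ⁆ = 0 ∀ δ ∈ h₁(p)}`,
`N(p) = {η ∈ C₁(L) : p ⁅ξ, η⁆ = 0 ∀ ξ ∈ G₁}` and `R(p)` the radical of `B_p`,
one has `dim R(p) = dim k(p) + dim N(p)`. -/
theorem finrank_radical_eq_finrank_k_add_finrank_N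
    (K : Type*) [Field K] [CharZero K] (r : ℕ) (hr : 2 ≤ r)
    (p : Module.Dual K (FreeNilpotentLie K r 3)) :
    Module.finrank K (radicalBp p) =
      Module.finrank K
        ↥((FreeNilpotentLie.G1 K r 3 ⊓
            perpRight p (LieModule.lowerCentralSeries K (FreeNilpotentLie K r 3)
              (FreeNilpotentLie K r 3) 1 : Set (FreeNilpotentLie K r 3))) ⊓
          perpLeft p ((FreeNilpotentLie.G1 K r 3 ⊓
            perpRight p (LieModule.lowerCentralSeries K (FreeNilpotentLie K r 3)
              (FreeNilpotentLie K r 3) 1 : Set (FreeNilpotentLie K r 3)) :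
              Submodule K (FreeNilpotentLie K r 3)) : Set (FreeNilpotentLie K r 3))) +
      Module.finrank K
        ↥((LieModule.lowerCentralSeries K (FreeNilpotentLie K r 3)
            (FreeNilpotentLie K r 3) 1).toSubmodule ⊓
          perpLeft p (FreeNilpotentLie.G1 K r 3 : Set (FreeNilpotentLie K r 3))) := by
  refine finrank_radicalBp_of_isCompl p
    (FreeNilpotentLie.isCompl_G1_lowerCentralSeries_one K r 3 (by norm_num)) fun x hx y hy => ?_
  have h := lie_mem_lowerCentralSeries_add_two hx hy
  rw [FreeNilpotentLie.lowerCentralSeries_eq_bot, LieSubmodule.mem_bot] at h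
  rw [h, map_zero]
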